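/- arXiv:2205.15297 — 2 statements merged into one kernel-verified Lean document; each statement's English description precedes it below -/
import Mathlib

section
/- Let (R,m,k) be a regular Noetherian local ring of dimension 1 and L a finitely generated R-module. Let H^0_m(L) = {z ∈ L : m^n z = 0 for some n ≥ 0} be the m-torsion submodule of L, and let c be an integer with m^c · H^0_m(L) = 0. Define φ(M) := length_R(M/m^cM) for finitely generated R-modules M. Then for every finitely generated free R-module F, every short exact sequence 0 → F → X → L → 0 of finitely generated R-modules satisfying both μ(X) = μ(F) + μ(L) and φ(X) = φ(F) + φ(L) is split exact. -/
open IsLocalRing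

/-- The minimal number of generators `μ(M) = dim_k (M/𝔪M)` of a module over a local ring. -/
noncomputable def mu (R : Type) [CommRing R] [IsLocalRing R]
    (M : Type) [AddCommGroup M] [Module R M] : ℕ :=
  Module.finrank (R ⧸ maximalIdeal R)
    (M ⧸ (maximalIdeal R • ⊤ : Submodule R M))

/-- A local ring is regular if its maximal ideal is generated by `dim R` elements. -/
def IsRegularLocal (R : Type) [CommRing R] [IsLocalRing R] : Prop :=
  ∃ (n : ℕ) (x : Fin n → R), Ideal.span (Set.range x) = maximalIdeal R ∧
    ringKrullDim R = n

/-- The length of an `R`-module, as the Krull dimension of its lattice of submodules. -/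
noncomputable def moduleLength (R : Type) [CommRing R]
    (M : Type) [AddCommGroup M] [Module R M] : WithBot ℕ∞ :=
  Order.krullDim (Submodule R M)

/-- `φ_c(M) := length_R (M / 𝔪^c M)`. -/
noncomputable def phi (R : Type) [CommRing R] [IsLocalRing R] (c : ℕ)
    (M : Type) [AddCommGroup M] [Module R M] : WithBot ℕ∞ :=
  moduleLength R (M ⧸ ((maximalIdeal R ^ c) • ⊤ : Submodule R M))

theorem aux_domain (R : Type) [CommRing R] [IsLocalRing R] [IsNoetherianRing R]
    (t : R) (ht : maximalIdeal R = Ideal.span {t}) (hdim : ringKrullDim R = 1) : IsDomain R := by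
  have hnil : ¬ IsNilpotent t := by
    intro hn
    have : Ring.KrullDimLE 0 R := by
      rw [Ring.krullDimLE_zero_iff]
      intro I hI
      have h1 : maximalIdeal R ≤ I := by
        rw [ht, Ideal.span_singleton_le_iff_mem]
        obtain ⟨n, hn⟩ := hn
        exact hI.mem_of_pow_mem n (hn ▸ I.zero_mem)
      have := (IsLocalRing.le_maximalIdeal hI.ne_top).antisymm h1
      rw [this]
      infer_instance
    have h0 := (Ring.krullDimLE_iff (R := R) (n := 0)).1 this
    rw [hdim] at h0
    norm_num at h0
  have key : ∀ a : R, a ≠ 0 → ∃ n : ℕ, ∃ u : R, IsUnit u ∧ a = u * t ^ n := by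
    intro a ha
    by_contra! hcon
    apply ha
    have hk := Ideal.iInf_pow_eq_bot_of_isLocalRing (maximalIdeal R) (Ideal.IsPrime.ne_top')
    rw [← Ideal.mem_bot, ← hk, Ideal.mem_iInf]
    intro n
    rw [ht, Ideal.span_singleton_pow, Ideal.mem_span_singleton']
    induction n with
    | zero => exact ⟨a, by simp⟩
    | succ n ih =>
      obtain ⟨b, hb⟩ := ih
      have hbu : ¬ IsUnit b := fun h => hcon n b h hb.symm
      have hbm : b ∈ maximalIdeal R := (IsLocalRing.mem_maximalIdeal b).2 hbu
      rw [ht, Ideal.mem_span_singleton'] at hbm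
      obtain ⟨d, hd⟩ := hbm
      exact ⟨d, by rw [← hb, ← hd]; ring⟩
  have : NoZeroDivisors R := by
    constructor
    intro a b hab
    by_contra! hcon
    obtain ⟨n, u, hu, rfl⟩ := key a hcon.1
    obtain ⟨m, v, hv, rfl⟩ := key b hcon.2
    have h2 : (u * v) * t ^ (n + m) = 0 := by rw [← hab]; ring
    rw [(hu.mul hv).mul_right_eq_zero] at h2
    exact hnil ⟨_, h2⟩
  exact NoZeroDivisors.to_isDomain R

theorem aux_fin (R : Type) [CommRing R] [IsDomain R] [IsDiscreteValuationRing R]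
    (X : Type) [AddCommGroup X] [Module R X] [Module.Finite R X] (c : ℕ) :
    Module.length R (X ⧸ ((maximalIdeal R ^ c) • ⊤ : Submodule R X)) ≠ ⊤ := by
  have h1 : Module.length R (R ⧸ maximalIdeal R ^ c) ≠ ⊤ := by
    rw [IsDiscreteValuationRing.length_quotient_pow_maximalIdeal]
    simp
  obtain ⟨n, p, hp⟩ := Module.Finite.exists_fin' R X
  let I := maximalIdeal R ^ c
  let q : (Fin n → R ⧸ I) →ₗ[R] (X ⧸ (I • ⊤ : Submodule R X)) :=
    LinearMap.lsum R (fun _ => R ⧸ I) R (fun i => Submodule.liftQ I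
      (LinearMap.toSpanSingleton R _ (Submodule.Quotient.mk (p (Pi.single i 1)))) (by
        intro r hr
        rw [LinearMap.mem_ker, LinearMap.toSpanSingleton_apply, ← Submodule.Quotient.mk_smul,
          Submodule.Quotient.mk_eq_zero]
        exact Submodule.smul_mem_smul hr trivial))
  have hq : Function.Surjective q := by
    intro y
    obtain ⟨x, rfl⟩ := Submodule.Quotient.mk_surjective _ y
    obtain ⟨v, rfl⟩ := hp x
    refine ⟨fun i => Ideal.Quotient.mk I (v i), ?_⟩
    simp only [q, LinearMap.lsum_apply, LinearMap.sum_apply, LinearMap.comp_apply,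
      LinearMap.proj_apply]
    rw [LinearMap.pi_apply_eq_sum_univ p v, ← Submodule.mkQ_apply, map_sum]
    refine Finset.sum_congr rfl fun i _ => ?_
    rw [map_smul]
    erw [Submodule.liftQ_apply]
    have hs : (fun j => if i = j then (1 : R) else 0) = Pi.single i 1 := by
      ext j
      simp [Pi.single_apply, eq_comm]
    rw [hs]
    rfl
  refine ne_top_of_le_ne_top ?_ (Module.length_le_of_surjective q hq)
  rw [Module.length_pi_of_fintype]
  simp only [I, IsDiscreteValuationRing.length_quotient_pow_maximalIdeal, Finset.sum_const,
    nsmul_eq_mul]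
  exact_mod_cast ENat.natCast_ne_top _

theorem aux_pure (R : Type) [CommRing R] (I : Ideal R)
    (F X L : Type) [AddCommGroup F] [Module R F] [AddCommGroup X] [Module R X]
    [AddCommGroup L] [Module R L]
    (f : F →ₗ[R] X) (g : X →ₗ[R] L) (hg : Function.Surjective g) (hfg : Function.Exact f g)
    (hF : Module.length R (F ⧸ (I • ⊤ : Submodule R F)) ≠ ⊤)
    (hX : Module.length R (X ⧸ (I • ⊤ : Submodule R X)) ≠ ⊤)
    (hlen : Module.length R (X ⧸ (I • ⊤ : Submodule R X)) =
      Module.length R (F ⧸ (I • ⊤ : Submodule R F)) +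
      Module.length R (L ⧸ (I • ⊤ : Submodule R L)))
    (y : F) (hy : f y ∈ (I • ⊤ : Submodule R X)) : y ∈ (I • ⊤ : Submodule R F) := by
  have hf' : (I • ⊤ : Submodule R F) ≤ (I • ⊤ : Submodule R X).comap f := by
    rw [← Submodule.map_le_iff_le_comap, Submodule.map_smul'']
    exact Submodule.smul_mono le_rfl le_top
  have hg' : (I • ⊤ : Submodule R X) ≤ (I • ⊤ : Submodule R L).comap g := by
    rw [← Submodule.map_le_iff_le_comap, Submodule.map_smul'']
    exact Submodule.smul_mono le_rfl le_top
  let fb := Submodule.mapQ _ _ f hf'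
  let gb := Submodule.mapQ _ _ g hg'
  have hgb : Function.Surjective gb := by
    intro y
    obtain ⟨l, rfl⟩ := Submodule.Quotient.mk_surjective _ y
    obtain ⟨x, rfl⟩ := hg l
    exact ⟨Submodule.Quotient.mk x, rfl⟩
  have hex : Function.Exact fb gb := by
    intro z
    obtain ⟨x, rfl⟩ := Submodule.Quotient.mk_surjective _ z
    constructor
    · intro h
      have h1 : g x ∈ (I • ⊤ : Submodule R L) := (Submodule.Quotient.mk_eq_zero _).1 h
      rw [← LinearMap.range_eq_top.2 hg, LinearMap.range_eq_map, ← Submodule.map_smul''] at h1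
      obtain ⟨x', hx', hxx⟩ := h1
      have : g (x - x') = 0 := by rw [map_sub, hxx, sub_self]
      obtain ⟨w, hw⟩ := (hfg _).1 this
      refine ⟨Submodule.Quotient.mk w, ?_⟩
      change Submodule.Quotient.mk (f w) = _
      rw [hw, Submodule.Quotient.eq]
      simpa using hx'
    · rintro ⟨w, hw⟩
      obtain ⟨w, rfl⟩ := Submodule.Quotient.mk_surjective _ w
      rw [← hw]
      change Submodule.Quotient.mk (g (f w)) = _
      rw [hfg.apply_apply_eq_zero, Submodule.Quotient.mk_zero]
  have e1 := Module.length_eq_add_of_exact (LinearMap.range fb).subtype gb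
    (Submodule.subtype_injective _) hgb (by
      rw [LinearMap.exact_iff, Submodule.range_subtype]; exact (LinearMap.exact_iff.1 hex))
  have e2 := Module.length_eq_add_of_exact (LinearMap.ker fb).subtype fb.rangeRestrict
    (Submodule.subtype_injective _) fb.surjective_rangeRestrict (by
      rw [LinearMap.exact_iff, Submodule.range_subtype, LinearMap.ker_rangeRestrict])
  have hk : Module.length R (LinearMap.ker fb) = 0 := by
    generalize Module.length R (X ⧸ (I • ⊤ : Submodule R X)) = a at *
    generalize Module.length R (F ⧸ (I • ⊤ : Submodule R F)) = b at *
    generalize Module.length R (L ⧸ (I • ⊤ : Submodule R L)) = d at *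
    generalize Module.length R (LinearMap.ker fb) = k at *
    generalize Module.length R (LinearMap.range fb) = r at *
    lift a to ℕ using hX
    lift b to ℕ using hF
    have hd : d ≠ ⊤ := by rintro rfl; simp at hlen
    have hr : r ≠ ⊤ := by rintro rfl; simp at e1
    have hkk : k ≠ ⊤ := by rintro rfl; simp at e2
    lift d to ℕ using hd
    lift r to ℕ using hr
    lift k to ℕ using hkk
    norm_cast at *
    omega
  rw [Module.length_eq_zero_iff] at hk
  have hker : (Submodule.Quotient.mk y : F ⧸ (I • ⊤ : Submodule R F)) ∈ LinearMap.ker fb := by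
    rw [LinearMap.mem_ker]
    exact (Submodule.Quotient.mk_eq_zero _).2 hy
  have := congrArg Subtype.val (Subsingleton.elim (⟨_, hker⟩ : LinearMap.ker fb) 0)
  exact (Submodule.Quotient.mk_eq_zero _).1 this

/-- Let `(R,𝔪,k)` be a regular Noetherian local ring of dimension `1` and `L` a finitely
generated module.  Let `c` be an integer with `𝔪^c • H⁰_𝔪(L) = 0` and set
`φ(M) := length_R (M/𝔪^c M)`.  Then for every finitely generated free module `F`, every
short exact sequence `0 → F → X → L → 0` of finitely generated modules which is both
`μ`-additive and `φ`-additive is split exact. -/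
theorem stmt11 (R : Type) [CommRing R] [IsLocalRing R] [IsNoetherianRing R]
    (hreg : IsRegularLocal R) (hdim : ringKrullDim R = 1)
    (L : Type) [AddCommGroup L] [Module R L] [Module.Finite R L]
    (c : ℕ)
    (hc : ∀ z : L, (∃ n : ℕ, ∀ r ∈ maximalIdeal R ^ n, r • z = 0) →
      ∀ r ∈ maximalIdeal R ^ c, r • z = 0) :
    ∀ (F : Type) [AddCommGroup F] [Module R F] [Module.Finite R F] [Module.Free R F],
    ∀ (X : Type) [AddCommGroup X] [Module R X] [Module.Finite R X]
      (f : F →ₗ[R] X) (g : X →ₗ[R] L),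
      Function.Injective f → Function.Surjective g → Function.Exact f g →
      mu R X = mu R F + mu R L →
      phi R c X = phi R c F + phi R c L →
      ∃ s : L →ₗ[R] X, g ∘ₗ s = LinearMap.id := by
  intro F _ _ _ _ X _ _ _ f g hf hg hfg _ hphi
  obtain ⟨n, x, hx, hn⟩ := hreg
  have hn1 : n = 1 := by
    rw [hdim] at hn; exact_mod_cast hn.symm
  subst hn1
  obtain ⟨t, ht⟩ : ∃ t : R, maximalIdeal R = Ideal.span {t} :=
    ⟨x 0, by rw [← hx, Set.range_unique]; rfl⟩
  have hdom : IsDomain R := aux_domain R t ht hdim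
  have hprin : (maximalIdeal R).IsPrincipal := ⟨⟨t, ht⟩⟩
  have hpid : IsPrincipalIdealRing R :=
    ((tfae_of_isNoetherianRing_of_isLocalRing_of_isDomain R).out 4 0).1 hprin
  have hne : maximalIdeal R ≠ ⊥ := by
    intro h
    have := ringKrullDim_eq_zero_of_isField (IsLocalRing.isField_iff_maximalIdeal_eq.2 h)
    rw [hdim] at this
    norm_num at this
  have hdvr : IsDiscreteValuationRing R := { not_a_field' := hne }
  have ht0 : t ≠ 0 := by
    rintro rfl; apply hne; rw [ht]; simp
  have hpow : maximalIdeal R ^ c = Ideal.span {t ^ c} := by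
    rw [ht, Ideal.span_singleton_pow]
  have hlen : Module.length R (X ⧸ ((maximalIdeal R ^ c) • ⊤ : Submodule R X)) =
      Module.length R (F ⧸ ((maximalIdeal R ^ c) • ⊤ : Submodule R F)) +
      Module.length R (L ⧸ ((maximalIdeal R ^ c) • ⊤ : Submodule R L)) := by
    apply WithBot.coe_injective
    rw [WithBot.coe_add, Module.coe_length, Module.coe_length, Module.coe_length]
    exact hphi
  have hpure := aux_pure R (maximalIdeal R ^ c) F X L f g hg hfg (aux_fin R F c)
    (aux_fin R X c) hlen
  -- lifting elements with principal annihilator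
  have hlift : ∀ (l : L) (q : R), q • l = 0 → (∃ k, maximalIdeal R ^ k ≤ Ideal.span {q}) →
      (∀ r : R, r • l = 0 → q ∣ r) → ∃ z : X, g z = l ∧ q • z = 0 := by
    intro l q hql ⟨k, hk⟩ hann
    have htc : t ^ c • l = 0 := by
      refine hc l ⟨k, fun r hr => ?_⟩ (t ^ c) (by rw [hpow]; exact Ideal.mem_span_singleton_self _)
      obtain ⟨a, rfl⟩ := Ideal.mem_span_singleton'.1 (hk hr)
      rw [mul_smul, hql, smul_zero]
    obtain ⟨d, hd⟩ := hann _ htc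
    have hd0 : d ≠ 0 := by
      rintro rfl
      exact pow_ne_zero c ht0 (by simpa using hd)
    obtain ⟨z, rfl⟩ := hg l
    obtain ⟨y, hy⟩ := (hfg (q • z)).1 (by rw [map_smul, hql])
    have h1 : f (d • y) ∈ ((maximalIdeal R ^ c) • ⊤ : Submodule R X) := by
      rw [map_smul, hy, smul_smul, mul_comm, ← hd, hpow]
      exact Submodule.smul_mem_smul (Ideal.mem_span_singleton_self _) trivial
    have h2 := hpure _ h1
    rw [hpow, Submodule.ideal_span_singleton_smul, Submodule.mem_smul_pointwise_iff_exists] at h2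
    obtain ⟨y', -, hy'⟩ := h2
    have h3 : d • (q • y') = d • y := by rw [← hy', smul_smul, hd, mul_comm]
    have h4 : q • y' = y := smul_right_injective F hd0 h3
    refine ⟨z - f y', ?_, ?_⟩
    · rw [map_sub, hfg.apply_apply_eq_zero, sub_zero]
    · rw [smul_sub, ← hy, ← map_smul, h4, sub_self]
  classical
  obtain ⟨n, ι, _, p, hp, e, ⟨E⟩⟩ := Module.equiv_free_prod_directSum (R := R) (M := L)
  choose v hv using fun i : Fin n => hg (E.symm (Finsupp.single i 1, 0))
  have hw : ∀ i : ι, ∃ z : X, g z = E.symm (0, DirectSum.lof R ι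
      (fun i => R ⧸ Submodule.span R {p i ^ e i}) i (Submodule.Quotient.mk 1)) ∧
      (p i ^ e i) • z = 0 := by
    intro i
    have hz : ∀ r : R, r • E.symm (0, DirectSum.lof R ι
      (fun i => R ⧸ Submodule.span R {p i ^ e i}) i (Submodule.Quotient.mk 1)) = 0 ↔
        p i ^ e i ∣ r := by
      intro r
      rw [← map_smul, LinearEquiv.map_eq_zero_iff, Prod.smul_mk, smul_zero, ← map_smul,
        Prod.mk_eq_zero, ← Submodule.Quotient.mk_smul]
      simp only [true_and]
      rw [← Ideal.mem_span_singleton]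
      constructor
      · intro h
        have h' := congrArg (DirectSum.component R ι _ i) h
        rw [DirectSum.component.lof_self, map_zero, Submodule.Quotient.mk_eq_zero] at h'
        simpa using h'
      · intro h
        rw [(Submodule.Quotient.mk_eq_zero _).2 (by simpa using h), map_zero]
    refine hlift _ _ ((hz _).2 dvd_rfl) ⟨e i, ?_⟩ (fun r => (hz r).1)
    rw [← Ideal.span_singleton_pow, (hp i).maximalIdeal_eq]
  choose w hw1 hw2 using hw
  let S : ((Fin n →₀ R) × DirectSum ι fun i => R ⧸ Submodule.span R {p i ^ e i}) →ₗ[R] X :=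
    LinearMap.coprod (Finsupp.linearCombination R v)
      (DirectSum.toModule R ι X fun i => Submodule.liftQ _ (LinearMap.toSpanSingleton R X (w i))
        (by
          rw [Submodule.span_le, Set.singleton_subset_iff]
          exact hw2 i))
  have hS : g ∘ₗ S = E.symm.toLinearMap := by
    apply LinearMap.prod_ext
    · ext i
      simp [S, hv]
    · apply DirectSum.linearMap_ext
      intro i
      apply Submodule.linearMap_qext
      ext
      simp only [S, LinearMap.comp_apply, LinearMap.inr_apply, LinearMap.coprod_apply, map_zero,
        zero_add, DirectSum.toModule_lof, Submodule.mkQ_apply, LinearEquiv.coe_coe]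
      rw [← hw1]
      exact congrArg g (one_smul R (w i))
  refine ⟨S ∘ₗ E.toLinearMap, ?_⟩
  rw [← LinearMap.comp_assoc, hS]
  ext; simp
end

section
/- Let (R,m,k) be a Cohen–Macaulay Noetherian local ring of dimension d that has minimal multiplicity, i.e., there is a system of parameters x_1, …, x_d with m² = (x_1,…,x_d)m. If Ext^1_R(Ω^d_R k, R)^μ = 0, i.e., every μ-additive short exact sequence 0 → R → X → Ω^d_R k → 0 of finitely generated R-modules splits, then Ext^{d+1}_R(k,R) = 0 and R is Gorenstein (R has finite injective dimension as a module over itself); combined with minimal multiplicity this forces μ(m) ≤ d + 1, i.e., R is a hypersurface. -/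
open IsLocalRing CategoryTheory

/-- `depth ≥ n`: there is an `M`-regular sequence of length `n` inside the maximal ideal. -/
def depthGE (R : Type) [CommRing R] [IsLocalRing R]
    (M : Type) [AddCommGroup M] [Module R M] (n : ℕ) : Prop :=
  ∃ rs : List R, rs.length = n ∧ (∀ r ∈ rs, r ∈ maximalIdeal R) ∧
    RingTheory.Sequence.IsRegular M rs

/-- `S` is an `i`-th syzygy of the residue field `k` in a minimal free resolution. -/
def IsMinSyzygyOfResidueField (R : Type) [CommRing R] [IsLocalRing R] (i : ℕ)
    (S : Type) [AddCommGroup S] [Module R S] : Prop :=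
  ∃ (b : ℕ → ℕ) (f : ∀ j : ℕ, ((Fin (b (j+1)) → R) →ₗ[R] (Fin (b j) → R)))
    (ε : (Fin (b 0) → R) →ₗ[R] R ⧸ maximalIdeal R),
    Function.Surjective ε ∧
    Function.Exact (f 0) ε ∧
    (∀ j, Function.Exact (f (j+1)) (f j)) ∧
    LinearMap.ker ε ≤ (maximalIdeal R) • (⊤ : Submodule R (Fin (b 0) → R)) ∧
    (∀ j, LinearMap.range (f j) ≤ (maximalIdeal R) • (⊤ : Submodule R (Fin (b j) → R))) ∧
    ((i = 0 ∧ Nonempty (S ≃ₗ[R] R ⧸ maximalIdeal R)) ∨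
      (∃ j, i = j + 1 ∧ Nonempty (S ≃ₗ[R] LinearMap.range (f j))))

/-- `N` has finite injective dimension. -/
def HasFiniteInjDim (R : Type) [CommRing R] (N : Type) [AddCommGroup N] [Module R N] : Prop :=
  ∃ (n : ℕ) (I : ℕ → ModuleCat.{0} R) (f : ∀ j : ℕ, (I j →ₗ[R] I (j+1)))
    (ι : N →ₗ[R] I 0),
    (∀ j, Module.Injective R (I j)) ∧
    Function.Injective ι ∧
    Function.Exact ι (f 0) ∧
    (∀ j, Function.Exact (f j) (f (j+1))) ∧
    (∀ j, n < j → Subsingleton (I j))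

instance moduleCatHasExt (R : Type) [CommRing R] : HasExt.{1} (ModuleCat.{0} R) := by
  letI := HasDerivedCategory.standard (ModuleCat.{0} R)
  exact hasExt_of_hasDerivedCategory _


open Abelian

section ExtPart

/-- Prefer `Ext` in universe zero in this section. -/
local instance (priority := 2000) extUnivZero (R : Type) [CommRing R] :
    HasExt.{0} (ModuleCat.{0} R) := inferInstance

/-- Vanishing of `Ext^i(N, M)`. -/
def EV (R : Type) [CommRing R] (M N : Type) [AddCommGroup M] [Module R M]
    [AddCommGroup N] [Module R N] (i : ℕ) : Prop :=
  Subsingleton (Ext.{0} (ModuleCat.of R N) (ModuleCat.of R M) i)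

variable {R : Type} [CommRing R] {M A B C : Type} [AddCommGroup M] [Module R M]
  [AddCommGroup A] [Module R A] [AddCommGroup B] [Module R B] [AddCommGroup C] [Module R C]

lemma ses_mk {f : A →ₗ[R] B} {g : B →ₗ[R] C} (hf : Function.Injective f)
    (hg : Function.Surjective g) (hfg : Function.Exact f g) :
    (ModuleCat.shortComplexOfCompEqZero f g hfg.linearMap_comp_eq_zero).ShortExact :=
  ModuleCat.shortComplex_shortExact _ hfg hf hg

lemma EV.zero (h : EV R M A i) (e : Ext.{0} (ModuleCat.of R A) (ModuleCat.of R M) i) : e = 0 := by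
  have : Subsingleton (Ext.{0} (ModuleCat.of R A) (ModuleCat.of R M) i) := h
  exact Subsingleton.elim _ _

lemma EV.of_zero (h : ∀ e : Ext.{0} (ModuleCat.of R A) (ModuleCat.of R M) i, e = 0) :
    EV R M A i := ⟨fun a b => by rw [h a, h b]⟩

lemma EV.congr (e : A ≃ₗ[R] B) (h : EV R M A i) : EV R M B i := by
  refine EV.of_zero fun x => ?_
  have h1 : ModuleCat.ofHom e.symm.toLinearMap ≫ ModuleCat.ofHom e.toLinearMap
      = 𝟙 (ModuleCat.of R B) := by
    ext; simp
  have : (Ext.mk₀ (ModuleCat.ofHom e.symm.toLinearMap)).comp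
    ((Ext.mk₀ (ModuleCat.ofHom e.toLinearMap)).comp x (zero_add i)) (zero_add i) = x := by
    rw [Ext.mk₀_comp_mk₀_assoc, h1, Ext.mk₀_id_comp]
  rw [← this, h.zero ((Ext.mk₀ (ModuleCat.ofHom e.toLinearMap)).comp x (zero_add i)), Ext.comp_zero]

lemma EV.mid {f : A →ₗ[R] B} {g : B →ₗ[R] C} (hf : Function.Injective f)
    (hg : Function.Surjective g) (hfg : Function.Exact f g) {i : ℕ}
    (hA : EV R M A i) (hC : EV R M C i) : EV R M B i := by
  refine EV.of_zero fun x => ?_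
  obtain ⟨y, hy⟩ := Ext.contravariant_sequence_exact₂ (ses_mk hf hg hfg) (ModuleCat.of R M) x
    (hA.zero _)
  rw [← hy, hC.zero y, Ext.comp_zero]

lemma EV.left {f : A →ₗ[R] B} {g : B →ₗ[R] C} (hf : Function.Injective f)
    (hg : Function.Surjective g) (hfg : Function.Exact f g) {i : ℕ}
    (hB : EV R M B i) (hC : EV R M C (i + 1)) : EV R M A i := by
  refine EV.of_zero fun x => ?_
  obtain ⟨y, hy⟩ := Ext.contravariant_sequence_exact₁ (ses_mk hf hg hfg) (ModuleCat.of R M) x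
    (add_comm 1 i) (hC.zero _)
  rw [← hy, hB.zero y, Ext.comp_zero]

lemma EV.right {f : A →ₗ[R] B} {g : B →ₗ[R] C} (hf : Function.Injective f)
    (hg : Function.Surjective g) (hfg : Function.Exact f g) {i : ℕ}
    (hA : EV R M A i) (hB : EV R M B (i + 1)) : EV R M C (i + 1) := by
  refine EV.of_zero fun x => ?_
  obtain ⟨y, hy⟩ := Ext.contravariant_sequence_exact₃ (ses_mk hf hg hfg) (ModuleCat.of R M) x
    (hB.zero _) (add_comm 1 i)
  rw [← hy, hA.zero y, Ext.comp_zero]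

/-- covariant: `Ext^i(N, B)` and `Ext^{i+1}(N, A)` vanish, so does `Ext^i(N, C)`. -/
lemma EV.cov {f : A →ₗ[R] B} {g : B →ₗ[R] C} (hf : Function.Injective f)
    (hg : Function.Surjective g) (hfg : Function.Exact f g) {i : ℕ}
    (hB : EV R B M i) (hA : EV R A M (i + 1)) : EV R C M i := by
  refine EV.of_zero fun x => ?_
  obtain ⟨y, hy⟩ := Ext.covariant_sequence_exact₃ (ModuleCat.of R M) (ses_mk hf hg hfg) x
    rfl (hA.zero _)
  rw [← hy, hB.zero y, Ext.zero_comp]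

lemma EV.proj [Module.Projective R A] (i : ℕ) : EV R M A (i + 1) := by
  have : Projective (ModuleCat.of R A) := (IsProjective.iff_projective (R := R) A).mp inferInstance
  exact EV.of_zero fun x => Ext.eq_zero_of_projective x

lemma EV.inj [Module.Injective R M] (i : ℕ) : EV R M A (i + 1) := by
  have : Injective (ModuleCat.of R M) := (Module.injective_iff_injective_object R M).mp inferInstance
  exact EV.of_zero fun x => Ext.eq_zero_of_injective x

lemma EV.subs [Subsingleton A] (i : ℕ) : EV R M A i := by
  refine EV.of_zero fun x => ?_
  have h : 𝟙 (ModuleCat.of R A) = 0 := by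
    ext a; exact Subsingleton.elim (α := A) _ _
  rw [← Ext.mk₀_id_comp x, h, Ext.mk₀_zero, Ext.zero_comp]

lemma EV.hom_eq_zero (h : EV R M A 0) (f : A →ₗ[R] M) : f = 0 := by
  have h1 := h.zero (Ext.mk₀ (ModuleCat.ofHom f))
  rw [Ext.mk₀_eq_zero_iff] at h1
  have := congrArg ModuleCat.Hom.hom h1
  simpa using this

lemma EV.of_hom (h : ∀ f : A →ₗ[R] M, f = 0) : EV R M A 0 := by
  refine EV.of_zero fun x => ?_
  obtain ⟨f, rfl⟩ := (Ext.mk₀_bijective _ _).2 x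
  rw [Ext.mk₀_eq_zero_iff]
  ext a
  rw [h f.hom]; rfl

/-- Extension of homs. -/
lemma EV.extend {f : A →ₗ[R] B} {g : B →ₗ[R] C} (hf : Function.Injective f)
    (hg : Function.Surjective g) (hfg : Function.Exact f g) 
    (hC : EV R M C 1) (φ : A →ₗ[R] M) : ∃ ψ : B →ₗ[R] M, ψ ∘ₗ f = φ := by
  obtain ⟨y, hy⟩ := Ext.contravariant_sequence_exact₁ (ses_mk hf hg hfg) (ModuleCat.of R M)
    (Ext.mk₀ (ModuleCat.ofHom φ)) (n₁ := 1) rfl (hC.zero _)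
  obtain ⟨ψ, rfl⟩ := (Ext.mk₀_bijective _ _).2 y
  rw [Ext.mk₀_comp_mk₀] at hy
  have h2 := (Ext.mk₀_bijective _ _).1 hy
  exact ⟨ψ.hom, congrArg ModuleCat.Hom.hom h2⟩

lemma EV.of_extend {f : A →ₗ[R] B} {g : B →ₗ[R] C} (hf : Function.Injective f)
    (hg : Function.Surjective g) (hfg : Function.Exact f g) [Module.Projective R B]
    (h : ∀ φ : A →ₗ[R] M, ∃ ψ : B →ₗ[R] M, ψ ∘ₗ f = φ) : EV R M C 1 := by
  refine EV.of_zero fun x => ?_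
  obtain ⟨y, rfl⟩ := Ext.contravariant_sequence_exact₃ (ses_mk hf hg hfg) (ModuleCat.of R M) x
    ((EV.proj (A := B) 0).zero _) (n₀ := 0) rfl
  obtain ⟨φ, rfl⟩ := (Ext.mk₀_bijective _ _).2 y
  obtain ⟨ψ, hψ⟩ := h φ.hom
  have : φ = ModuleCat.ofHom f ≫ ModuleCat.ofHom ψ := by
    ext a; exact (LinearMap.congr_fun hψ a).symm
  rw [this, ← Ext.mk₀_comp_mk₀]
  exact ShortComplex.ShortExact.extClass_comp_assoc (ses_mk hf hg hfg) _

/-- Surjectivity of `Ext^i(B,M) → Ext^i(A,M)`. -/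
lemma ext_surj_left {f : A →ₗ[R] B} {g : B →ₗ[R] C} (hf : Function.Injective f)
    (hg : Function.Surjective g) (hfg : Function.Exact f g) {i : ℕ}
    (hC : EV R M C (i + 1)) (x : Ext.{0} (ModuleCat.of R A) (ModuleCat.of R M) i) :
    ∃ y : Ext.{0} (ModuleCat.of R B) (ModuleCat.of R M) i,
      (Ext.mk₀ (ModuleCat.ofHom f)).comp y (zero_add i) = x :=
  Ext.contravariant_sequence_exact₁ (ses_mk hf hg hfg) (ModuleCat.of R M) x
    (add_comm 1 i) (hC.zero _)

/-- Cyclicity of `Ext`. -/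
def EC (R : Type) [CommRing R] (M N : Type) [AddCommGroup M] [Module R M]
    [AddCommGroup N] [Module R N] (i : ℕ) : Prop :=
  ∃ e : Ext.{0} (ModuleCat.of R N) (ModuleCat.of R M) i, ∀ x, ∃ r : R, x = r • e

lemma EC.left {f : A →ₗ[R] B} {g : B →ₗ[R] C} (hf : Function.Injective f)
    (hg : Function.Surjective g) (hfg : Function.Exact f g) {i : ℕ}
    (hB : EC R M B i) (hC : EV R M C (i + 1)) : EC R M A i := by
  obtain ⟨e, he⟩ := hB
  refine ⟨(Ext.mk₀ (ModuleCat.ofHom f)).comp e (zero_add i), fun x => ?_⟩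
  obtain ⟨y, rfl⟩ := ext_surj_left hf hg hfg hC x
  obtain ⟨r, rfl⟩ := he y
  exact ⟨r, Ext.comp_smul _ _ _ _⟩

lemma EC.right {f : A →ₗ[R] B} {g : B →ₗ[R] C} (hf : Function.Injective f)
    (hg : Function.Surjective g) (hfg : Function.Exact f g) {i : ℕ}
    (hA : EC R M A i) (hB : EV R M B (i + 1)) : EC R M C (i + 1) := by
  obtain ⟨e, he⟩ := hA
  refine ⟨(ses_mk hf hg hfg).extClass.comp e (add_comm 1 i), fun x => ?_⟩
  obtain ⟨y, rfl⟩ := Ext.contravariant_sequence_exact₃ (ses_mk hf hg hfg) (ModuleCat.of R M) x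
    (hB.zero _) (add_comm 1 i)
  obtain ⟨r, rfl⟩ := he y
  exact ⟨r, Ext.comp_smul _ _ _ _⟩

lemma EC.self : EC R R R 0 := by
  refine ⟨Ext.mk₀ (𝟙 _), fun x => ?_⟩
  obtain ⟨f, rfl⟩ := (Ext.mk₀_bijective _ _).2 x
  refine ⟨f.hom (1 : R), ?_⟩
  rw [← Ext.mk₀_smul]
  congr 1
  ext
  change f.hom (1:R) = f.hom (1:R) • (1 : R)
  simp

/-- multiplication by `r` short exact sequence + Nakayama. -/
lemma EV.nak [IsLocalRing R] [IsNoetherianRing R] [Module.Finite R A] [Module.Finite R M]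
    {r : R} (hr : r ∈ maximalIdeal R) {g : A →ₗ[R] C}
    (hf : Function.Injective (LinearMap.lsmul R A r))
    (hg : Function.Surjective g) (hfg : Function.Exact (LinearMap.lsmul R A r) g) {i : ℕ}
    (hC : EV R M C (i + 1)) : EV R M A i := by
  have hs : ∀ x : Ext.{0} (ModuleCat.of R A) (ModuleCat.of R M) i, ∃ y, r • y = x := by
    intro x
    obtain ⟨y, hy⟩ := ext_surj_left hf hg hfg hC x
    refine ⟨y, ?_⟩
    have : ModuleCat.ofHom (LinearMap.lsmul R A r) = r • 𝟙 (ModuleCat.of R A) := rfl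
    rw [← hy, this, Ext.mk₀_smul, Ext.smul_comp, Ext.mk₀_id_comp]
  have h2 : (⊤ : Submodule R (Ext.{0} (ModuleCat.of R A) (ModuleCat.of R M) i)) = ⊥ := by
    refine Submodule.eq_bot_of_le_smul_of_le_jacobson_bot (maximalIdeal R) _ ?_ ?_ ?_
    · have : Module.Finite R (ModuleCat.of R A) := ‹Module.Finite R A›
      have : Module.Finite R (ModuleCat.of R M) := ‹Module.Finite R M›
      exact Module.Finite.fg_top
    · intro x _
      obtain ⟨y, rfl⟩ := hs x
      exact Submodule.smul_mem_smul hr trivial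
    · exact (IsLocalRing.jacobson_eq_maximalIdeal ⊥ bot_ne_top).ge
  refine EV.of_zero fun x => ?_
  have : x ∈ (⊤ : Submodule R (Ext.{0} (ModuleCat.of R A) (ModuleCat.of R M) i)) := trivial
  rw [h2] at this
  exact this

end ExtPart

section AlgPart

variable {R : Type} [CommRing R]

lemma EV.devissage [IsNoetherianRing R] {M : Type} [AddCommGroup M] [Module R M]
    (Q : Ideal R) (i : ℕ) (h : ∀ p : Ideal R, p.IsPrime → Q ≤ p → EV R M (R ⧸ p) i)
    (N : Type) [AddCommGroup N] [Module R N] [hfin : Module.Finite R N]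
    (hN : Q ≤ Module.annihilator R N) : EV R M N i := by
  revert hN
  refine IsNoetherianRing.induction_on_isQuotientEquivQuotientPrime R hfin
    (motive := fun N _ _ _ => Q ≤ Module.annihilator R N → EV R M N i) ?_ ?_ ?_
  · intro N _ _ _ _ _
    exact EV.subs i
  · intro N _ _ _ p e hN
    refine EV.congr e.symm (h p.1 p.2 ?_)
    rwa [e.annihilator_eq, Ideal.annihilator_quotient] at hN
  · intro N₁ _ _ _ N₂ _ _ _ N₃ _ _ _ f g hf hg hfg h1 h3 hN
    exact EV.mid hf hg hfg (h1 (hN.trans (f.annihilator_le_of_injective hf)))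
      (h3 (hN.trans (g.annihilator_le_of_surjective hg)))

/-- The projection `R/Q → R/(Q + r)`. -/
noncomputable def qproj (Q : Ideal R) (r : R) : (R ⧸ Q) →ₗ[R] (R ⧸ (Q ⊔ Ideal.span {r})) :=
  Submodule.factor le_sup_left

lemma qproj_mk (Q : Ideal R) (r a : R) :
    qproj Q r (Ideal.Quotient.mk Q a) = Ideal.Quotient.mk _ a := rfl

lemma qproj_surj (Q : Ideal R) (r : R) : Function.Surjective (qproj Q r) := by
  intro y
  obtain ⟨a, rfl⟩ := Ideal.Quotient.mk_surjective y
  exact ⟨Ideal.Quotient.mk Q a, rfl⟩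

lemma smul_mk_eq (Q : Ideal R) (r a : R) :
    LinearMap.lsmul R (R ⧸ Q) r (Ideal.Quotient.mk Q a) = Ideal.Quotient.mk Q (r * a) := rfl

lemma qproj_exact (Q : Ideal R) (r : R) :
    Function.Exact (LinearMap.lsmul R (R ⧸ Q) r) (qproj Q r) := by
  intro y
  obtain ⟨a, rfl⟩ := Ideal.Quotient.mk_surjective y
  rw [qproj_mk, Ideal.Quotient.eq_zero_iff_mem, Submodule.mem_sup]
  constructor
  · rintro ⟨q, hq, z, hz, rfl⟩
    obtain ⟨c, rfl⟩ := Ideal.mem_span_singleton'.mp hz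
    refine ⟨Ideal.Quotient.mk Q c, ?_⟩
    rw [smul_mk_eq, map_add, Ideal.Quotient.eq_zero_iff_mem.mpr hq, zero_add, mul_comm]
  · rintro ⟨z, hz⟩
    obtain ⟨c, rfl⟩ := Ideal.Quotient.mk_surjective z
    rw [smul_mk_eq, Ideal.Quotient.eq] at hz
    refine ⟨a - r * c, ?_, r * c, Ideal.mem_span_singleton'.mpr ⟨c, mul_comm _ _⟩, by ring⟩
    rw [← neg_sub]
    exact Q.neg_mem hz

lemma smul_inj (Q : Ideal R) (r : R) (h : ∀ a, r * a ∈ Q → a ∈ Q) :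
    Function.Injective (LinearMap.lsmul R (R ⧸ Q) r) := by
  rw [injective_iff_map_eq_zero]
  intro y hy
  obtain ⟨a, rfl⟩ := Ideal.Quotient.mk_surjective y
  rw [smul_mk_eq, Ideal.Quotient.eq_zero_iff_mem] at hy
  exact Ideal.Quotient.eq_zero_iff_mem.mpr (h a hy)

variable [IsLocalRing R] [IsNoetherianRing R]

lemma EV.nakQ {M : Type} [AddCommGroup M] [Module R M] [Module.Finite R M] (Q : Ideal R) (r : R)
    (hr : r ∈ maximalIdeal R) (h : ∀ a, r * a ∈ Q → a ∈ Q) (i : ℕ)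
    (hC : EV R M (R ⧸ (Q ⊔ Ideal.span {r})) (i + 1)) : EV R M (R ⧸ Q) i :=
  EV.nak hr (smul_inj Q r h) (qproj_surj Q r) (qproj_exact Q r) hC

/-- Finite length devissage. -/
lemma EV.finlen {M : Type} [AddCommGroup M] [Module R M] (i k : ℕ)
    (hk : EV R M (R ⧸ maximalIdeal R) i) (N : Type) [AddCommGroup N] [Module R N]
    [Module.Finite R N] (hN : maximalIdeal R ^ k ≤ Module.annihilator R N) : EV R M N i := by
  refine EV.devissage (maximalIdeal R ^ k) i ?_ N hN
  intro p hp hle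
  have h1 : maximalIdeal R ≤ p := hp.le_of_pow_le hle
  have h2 : p = maximalIdeal R :=
    ((IsLocalRing.maximalIdeal.isMaximal R).eq_of_le hp.ne_top h1).symm
  rw [h2]; exact hk

/-- Ischebeck. -/
lemma ischebeck (d k : ℕ) (hk : ∀ i < d, EV R R (R ⧸ maximalIdeal R) i) (y : List R)
    (hy : ∀ r ∈ y, r ∈ maximalIdeal R) (Q : Ideal R)
    (hQ : maximalIdeal R ^ k ≤ Q ⊔ Ideal.ofList y) (i : ℕ) (hi : i + y.length < d) :
    EV R R (R ⧸ Q) i := by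
  induction y generalizing Q i with
  | nil =>
    refine EV.finlen i k (hk i (by simpa using hi)) _ ?_
    rw [Ideal.annihilator_quotient]
    simpa using hQ
  | cons r y ih =>
    have hy' : ∀ r ∈ y, r ∈ maximalIdeal R := fun s hs => hy s (List.mem_cons_of_mem _ hs)
    simp only [List.length_cons] at hi
    refine EV.devissage Q i ?_ _ (Ideal.annihilator_quotient (I := Q)).ge
    intro p hp hQp
    have hle : maximalIdeal R ^ k ≤ (p ⊔ Ideal.span {r}) ⊔ Ideal.ofList y := by
      refine hQ.trans ?_
      rw [Ideal.ofList_cons, ← sup_assoc]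
      exact sup_le_sup_right (sup_le_sup_right hQp _) _
    by_cases hrp : r ∈ p
    · have : p ⊔ Ideal.span {r} = p := by
        rw [sup_eq_left, Ideal.span_singleton_le_iff_mem]; exact hrp
      rw [this] at hle
      exact ih hy' p hle i (by omega)
    · refine EV.nakQ p r (hy r List.mem_cons_self) ?_ i (ih hy' _ hle (i + 1) (by omega))
      intro a ha
      exact (hp.mem_or_mem ha).resolve_left hrp

/-- Regular sequences -/
structure RS (d : ℕ) (y : ℕ → R) (I : ℕ → Ideal R) : Prop where
  zero : I 0 = ⊥
  succ : ∀ j, I (j + 1) = I j ⊔ Ideal.span {y j}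
  mem : ∀ j, y j ∈ maximalIdeal R
  reg : ∀ j < d, ∀ a, y j * a ∈ I j → a ∈ I j

lemma RS.exists (d : ℕ) (x : Fin d → R) (hx : ∀ i, x i ∈ maximalIdeal R)
    (k : ℕ) (hk : maximalIdeal R ^ k ≤ Ideal.span (Set.range x))
    (hdep : ∀ i < d, EV R R (R ⧸ maximalIdeal R) i) :
    ∃ (y : ℕ → R) (I : ℕ → Ideal R), RS d y I ∧ I d = Ideal.span (Set.range x) := by
  let y : ℕ → R := fun j => if h : j < d then x ⟨j, h⟩ else 0
  let I : ℕ → Ideal R := fun j => Ideal.span (y '' Set.Iio j)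
  have hsucc : ∀ j, I (j + 1) = I j ⊔ Ideal.span {y j} := by
    intro j
    simp only [I]
    rw [← Ideal.span_union, ← Set.image_singleton (f := y), ← Set.image_union]
    congr 2
    ext t; simp
  have hmem : ∀ j, y j ∈ maximalIdeal R := by
    intro j
    simp only [y]
    split_ifs
    · exact hx _
    · exact zero_mem _
  have hd : I d = Ideal.span (Set.range x) := by
    simp only [I]
    congr 1
    ext t
    constructor
    · rintro ⟨j, hj, rfl⟩
      have hj' : j < d := hj
      exact ⟨⟨j, hj'⟩, by simp [y, hj']⟩
    · rintro ⟨j, rfl⟩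
      exact ⟨j.1, j.2, by simp [y]⟩
  have h0 : I 0 = ⊥ := by simp [I]
  refine ⟨y, I, ⟨h0, hsucc, hmem, ?_⟩, hd⟩
  -- tail lists
  have htail : ∀ s j, j + s = d → ∃ l : List R, l.length = s ∧ (∀ r ∈ l, r ∈ maximalIdeal R) ∧
      I d ≤ I j ⊔ Ideal.ofList l := by
    intro s
    induction s with
    | zero => intro j hj; exact ⟨[], rfl, by simp, by simp at hj; simp [hj]⟩
    | succ s ih =>
      intro j hj
      obtain ⟨l, hl, hm, hle⟩ := ih (j + 1) (by omega)
      refine ⟨y j :: l, by simp [hl], ?_, ?_⟩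
      · intro r hr
        rcases List.mem_cons.mp hr with rfl | hr
        · exact hmem j
        · exact hm r hr
      · rw [Ideal.ofList_cons, ← sup_assoc, ← hsucc]; exact hle
  -- vanishing for quotient targets
  have key : ∀ j, j ≤ d → (∀ j' < j, ∀ a, y j' * a ∈ I j' → a ∈ I j') →
      ∀ (N : Type) [AddCommGroup N] [Module R N] (n : ℕ), (∀ i < n + j, EV R R N i) →
        ∀ i < n, EV R (R ⧸ I j) N i := by
    intro j
    induction j with
    | zero =>
      intro _ _ N _ _ n hN i hi
      rw [h0]
      have e : R ≃ₗ[R] (R ⧸ (⊥ : Ideal R)) := (Submodule.quotEquivOfEqBot ⊥ rfl).symm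
      refine EV.cov (A := (PUnit : Type)) (f := 0) (g := e.toLinearMap) ?_ e.surjective ?_
        (hN i (by simpa using hi)) ?_
      · intro a b _; rfl
      · intro a
        simp only [LinearEquiv.coe_coe, LinearEquiv.map_eq_zero_iff, LinearMap.zero_apply,
          Set.mem_range, exists_const]
        exact eq_comm
      · have : Module.Injective R PUnit := ⟨fun _ _ _ _ _ _ _ _ _ => ⟨0, fun _ => rfl⟩⟩
        exact EV.inj (M := PUnit) i
    | succ j ih =>
      intro hj hreg N _ _ n hN i hi
      have hN' := ih (by omega) (fun j' h' => hreg j' (by omega)) N (n + 1)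
        (fun i hi => hN i (by omega))
      rw [hsucc]
      exact EV.cov (smul_inj _ _ (hreg j (by omega))) (qproj_surj _ _) (qproj_exact _ _)
        (hN' i (by omega)) (hN' (i + 1) (by omega))
  intro j
  induction j using Nat.strong_induction_on with
  | _ j ihj =>
    intro hj a ha
    obtain ⟨l, hl, hm, hle⟩ := htail (d - (j + 1)) (j + 1) (by omega)
    have h1 : ∀ i < 1 + j, EV R R (R ⧸ I (j + 1)) i := by
      intro i hi
      exact ischebeck d k hdep l hm _ ((hk.trans hd.ge).trans hle) i (by omega)
    have h2 := key j hj.le (fun j' h' => ihj j' h' (by omega)) _ 1 h1 0 (by omega)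
    let φ : (R ⧸ I (j + 1)) →ₗ[R] (R ⧸ I j) :=
      Submodule.liftQ (I (j + 1)) (LinearMap.toSpanSingleton R (R ⧸ I j) (Ideal.Quotient.mk _ a)) (by
        rw [hsucc, sup_le_iff, Ideal.span_singleton_le_iff_mem]
        constructor
        · intro z hz
          change Ideal.Quotient.mk (I j) (z * a) = 0
          exact Ideal.Quotient.eq_zero_iff_mem.mpr ((I j).mul_mem_right _ hz)
        · change Ideal.Quotient.mk (I j) (y j * a) = 0
          exact Ideal.Quotient.eq_zero_iff_mem.mpr ha)
    have h3 := LinearMap.congr_fun (h2.hom_eq_zero φ) (Ideal.Quotient.mk _ 1)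
    have h4 : Ideal.Quotient.mk (I j) (1 * a) = 0 := h3
    rw [one_mul] at h4
    exact Ideal.Quotient.eq_zero_iff_mem.mp h4

variable {d : ℕ} {y : ℕ → R} {I : ℕ → Ideal R}

lemma RS.pd (h : RS d y I) (M : Type) [AddCommGroup M] [Module R M] (j : ℕ) (hj : j ≤ d) :
    ∀ i, j ≤ i → EV R M (R ⧸ I j) (i + 1) := by
  induction j with
  | zero =>
    intro i _
    rw [h.zero]
    exact EV.congr (Submodule.quotEquivOfEqBot ⊥ rfl).symm (EV.proj (A := R) i)
  | succ j ih =>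
    intro i hi
    obtain ⟨i, rfl⟩ : ∃ i', i = i' + 1 := ⟨i - 1, by omega⟩
    rw [h.succ]
    exact EV.right (smul_inj _ _ (h.reg j (by omega))) (qproj_surj _ _) (qproj_exact _ _)
      (ih (by omega) i (by omega)) (ih (by omega) (i + 1) (by omega))

lemma EC.congr {M A B : Type} [AddCommGroup M] [Module R M] [AddCommGroup A] [Module R A]
    [AddCommGroup B] [Module R B] {i : ℕ} (e : A ≃ₗ[R] B) (h : EC R M B i) : EC R M A i := by
  refine EC.left (C := PUnit) (f := e.toLinearMap) (g := 0) e.injective ?_ ?_ h (EV.subs _)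
  · intro a; exact ⟨0, rfl⟩
  · intro a; simp

lemma RS.cyc (h : RS d y I) (j : ℕ) (hj : j ≤ d) : EC R R (R ⧸ I j) j := by
  induction j with
  | zero =>
    rw [h.zero]
    exact EC.congr (Submodule.quotEquivOfEqBot ⊥ rfl) EC.self
  | succ j ih =>
    have h1 := h.pd R j (by omega) j le_rfl
    rw [h.succ]
    exact EC.right (smul_inj _ _ (h.reg j (by omega))) (qproj_surj _ _) (qproj_exact _ _)
      (ih (by omega)) h1

lemma RS.nonvanish (h : RS d y I) (j : ℕ) (hj : j ≤ d) : ¬ EV R R (R ⧸ I j) j := by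
  induction j with
  | zero =>
    intro h0
    rw [h.zero] at h0
    have h1 := (EV.congr (Submodule.quotEquivOfEqBot ⊥ rfl) h0).hom_eq_zero
      (LinearMap.id : R →ₗ[R] R)
    exact one_ne_zero (LinearMap.congr_fun h1 1)
  | succ j ih =>
    intro h1
    rw [h.succ] at h1
    exact ih (by omega) (EV.nakQ _ _ (h.mem j) (h.reg j (by omega)) j h1)

lemma RS.le (h : RS d y I) (j : ℕ) : I j ≤ maximalIdeal R := by
  induction j with
  | zero => rw [h.zero]; exact bot_le
  | succ j ih =>
    rw [h.succ, sup_le_iff, Ideal.span_singleton_le_iff_mem]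
    exact ⟨ih, h.mem j⟩

/-- exact sequence `m/I → R/I → k`. -/
lemma quot_ses (J K : Ideal R) (hJK : J ≤ K) :
    Function.Surjective (Submodule.factor hJK : (R ⧸ J) →ₗ[R] (R ⧸ K)) := by
  intro y
  obtain ⟨a, rfl⟩ := Ideal.Quotient.mk_surjective y
  exact ⟨Ideal.Quotient.mk J a, rfl⟩

lemma ann_sub {J : Ideal R} (N : Submodule R (R ⧸ J)) : J ≤ Module.annihilator R N := by
  refine le_trans ?_ (N.subtype.annihilator_le_of_injective N.injective_subtype)
  exact (Ideal.annihilator_quotient (I := J)).ge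

lemma RS.all_k (h : RS d y I) (k : ℕ) (hk : maximalIdeal R ^ k ≤ I d)
    (h1 : EV R R (R ⧸ maximalIdeal R) (d + 1)) :
    ∀ n, EV R R (R ⧸ maximalIdeal R) (d + 1 + n) := by
  intro n
  induction n with
  | zero => exact h1
  | succ n ih =>
    let g : (R ⧸ I d) →ₗ[R] (R ⧸ maximalIdeal R) := Submodule.factor (h.le d)
    refine EV.right (A := LinearMap.ker g) (f := (LinearMap.ker g).subtype) (g := g)
      (LinearMap.ker g).injective_subtype (quot_ses _ _ _) ?_ ?_ ?_
    · intro a; simp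
    · exact EV.finlen _ k ih _ (hk.trans (ann_sub _))
    · exact h.pd R d le_rfl (d + 1 + n) (by omega)

lemma bass (n : ℕ) (hk : ∀ i, n < i → EV R R (R ⧸ maximalIdeal R) i)
    (N : Type) [AddCommGroup N] [Module R N] [Module.Finite R N] (i : ℕ) (hi : n < i) :
    EV R R N i := by
  have key : ∀ p : Ideal R, p.IsPrime → ∀ i, n < i → EV R R (R ⧸ p) i := by
    intro p
    induction p using (wellFounded_gt (α := Ideal R)).induction with
    | _ p ih =>
      intro hp i hi
      by_cases hpm : p = maximalIdeal R
      · rw [hpm]; exact hk i hi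
      · obtain ⟨r, hr, hrp⟩ : ∃ r ∈ maximalIdeal R, r ∉ p := by
          by_contra hcon
          push Not at hcon
          exact hpm ((IsLocalRing.maximalIdeal.isMaximal R).eq_of_le hp.ne_top hcon).symm
        refine EV.nakQ p r hr (fun a ha => (hp.mem_or_mem ha).resolve_left hrp) i ?_
        refine EV.devissage (p ⊔ Ideal.span {r}) (i + 1) ?_ _ (Ideal.annihilator_quotient).ge
        intro q hq hle
        refine ih q ?_ hq _ (by omega)
        refine lt_of_le_of_ne (le_sup_left.trans hle) ?_
        rintro rfl
        exact hrp (hle (Ideal.mem_sup_right (Ideal.mem_span_singleton_self r)))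
  exact EV.devissage ⊥ i (fun p hp _ => key p hp i hi) N bot_le

end AlgPart

section ResPart

variable {R : Type} [CommRing R]

lemma dual_mem {n : ℕ} (J : Ideal R) (Φ : (Fin n → R) →ₗ[R] R) (u : Fin n → R)
    (hu : ∀ s, u s ∈ J) : Φ u ∈ J := by
  rw [LinearMap.pi_apply_eq_sum_univ Φ u]
  exact Ideal.sum_mem _ fun s _ => by
    rw [smul_eq_mul]; exact J.mul_mem_right _ (hu s)

lemma comp_mem {m n : ℕ} (J : Ideal R) (f : (Fin m → R) →ₗ[R] (Fin n → R)) (u : Fin m → R)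
    (hu : ∀ s, u s ∈ J) (t : Fin n) : f u t ∈ J :=
  dual_mem J (LinearMap.proj t ∘ₗ f) u hu

variable [IsLocalRing R] [IsNoetherianRing R]
variable {d : ℕ} {y : ℕ → R} {I : ℕ → Ideal R}

lemma RS.tor (h : RS d y I) (b : ℕ → ℕ)
    (f : ∀ j : ℕ, ((Fin (b (j+1)) → R) →ₗ[R] (Fin (b j) → R)))
    (hex : ∀ j, Function.Exact (f (j+1)) (f j)) (j : ℕ) (hj : j ≤ d) :
    ∀ i, j ≤ i → ∀ u : Fin (b (i+1)) → R, (∀ t, f i u t ∈ I j) →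
      ∃ v : Fin (b (i+1+1)) → R, ∀ t, (u - f (i+1) v) t ∈ I j := by
  induction j with
  | zero =>
    intro i _ u hu
    simp only [h.zero, Ideal.mem_bot] at hu ⊢
    obtain ⟨v, hv⟩ := (hex i u).mp (funext hu)
    exact ⟨v, fun t => by rw [hv]; simp⟩
  | succ j ih =>
    intro i hi u hu
    obtain ⟨i, rfl⟩ : ∃ i', i = i' + 1 := ⟨i - 1, by omega⟩
    have hI := ih (by omega)
    have h1 : ∀ t, ∃ w : R, f (i+1) u t - y j * w ∈ I j := by
      intro t
      have := hu t
      rw [h.succ, Submodule.mem_sup] at this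
      obtain ⟨p, hp, z, hz, hpz⟩ := this
      obtain ⟨c, rfl⟩ := Ideal.mem_span_singleton'.mp hz
      refine ⟨c, ?_⟩
      rw [← hpz]
      have : p + c * y j - y j * c = p := by ring
      rwa [this]
    choose w hw using h1
    have h2 : ∀ t, f i w t ∈ I j := by
      intro t
      refine h.reg j (by omega) _ ?_
      have h3 := comp_mem (I j) (f i) (f (i+1) u - y j • w) (fun s => by simpa using hw s) t
      rw [map_sub, (hex i).apply_apply_eq_zero, map_smul, zero_sub] at h3
      simpa using h3
    obtain ⟨v, hv⟩ := hI i (by omega) w h2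
    have h4 : ∀ t, f (i+1) (u - y j • v) t ∈ I j := by
      intro t
      have h5 := (I j).add_mem (hw t) ((I j).mul_mem_left (y j) (hv t))
      convert h5 using 1
      simp
      ring
    obtain ⟨v', hv'⟩ := hI (i+1) (by omega) _ h4
    refine ⟨v', fun t => ?_⟩
    rw [h.succ]
    have h6 := Ideal.add_mem (I j ⊔ Ideal.span {y j}) (Ideal.mem_sup_left (hv' t))
      (Ideal.mem_sup_right (Ideal.mem_span_singleton'.mpr ⟨v t, rfl⟩))
    convert h6 using 1
    simp
    ring

lemma mem_smul_top_comp {n : ℕ} (J : Ideal R) (u : Fin n → R)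
    (hu : u ∈ J • (⊤ : Submodule R (Fin n → R))) (t : Fin n) : u t ∈ J := by
  induction hu using Submodule.smul_induction_on' with
  | smul r hr n _ => simpa using J.mul_mem_right _ hr
  | add x _ y _ hx hy => exact J.add_mem hx hy

lemma RS.nofree (h : RS d y I) (b : ℕ → ℕ)
    (f : ∀ j : ℕ, ((Fin (b (j+1)) → R) →ₗ[R] (Fin (b j) → R)))
    (hex : ∀ j, Function.Exact (f (j+1)) (f j))
    (hmin : LinearMap.range (f d) ≤ (maximalIdeal R) • (⊤ : Submodule R (Fin (b d) → R)))
    (h2 : maximalIdeal R ^ 2 ≤ I d) (hm : ¬ maximalIdeal R ≤ I d)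
    (Φ : (Fin (b (d+1)) → R) →ₗ[R] R) (hΦ : ∀ v, Φ (f (d+1) v) = 0) (u) :
    Φ u ∈ maximalIdeal R := by
  by_contra hcon
  apply hm
  intro a ha
  have hun : IsUnit (Φ u) := by
    by_contra hn
    exact hcon ((mem_maximalIdeal _).mpr hn)
  have h1 : ∀ t, f d (a • u) t ∈ I d := by
    intro t
    refine h2 ?_
    rw [map_smul, pow_two]
    exact Ideal.mul_mem_mul ha (mem_smul_top_comp _ _ (hmin ⟨u, rfl⟩) t)
  obtain ⟨v, hv⟩ := h.tor b f hex d le_rfl d le_rfl _ h1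
  have h3 := dual_mem _ Φ _ hv
  rw [map_sub, hΦ, sub_zero, map_smul, smul_eq_mul] at h3
  exact (Ideal.mul_unit_mem_iff_mem _ hun).mp h3

end ResPart

section MuPart

variable {R : Type} [CommRing R] [IsLocalRing R]

lemma hasRN : HasRankNullity.{0} (R ⧸ maximalIdeal R) := by
  letI := Ideal.Quotient.field (maximalIdeal R)
  infer_instance

lemma strongRank : StrongRankCondition (R ⧸ maximalIdeal R) := by
  letI := Ideal.Quotient.field (maximalIdeal R)
  infer_instance

/-- Induced map on `M/mM`. -/
noncomputable def redMap {A B : Type} [AddCommGroup A] [Module R A] [AddCommGroup B] [Module R B]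
    (f : A →ₗ[R] B) : (A ⧸ (maximalIdeal R • ⊤ : Submodule R A)) →ₗ[R ⧸ maximalIdeal R]
      (B ⧸ (maximalIdeal R • ⊤ : Submodule R B)) :=
  LinearMap.extendScalarsOfSurjective (R := R) Ideal.Quotient.mk_surjective
    (Submodule.mapQ _ _ f (by
      rw [← Submodule.map_le_iff_le_comap, Submodule.map_smul'']
      exact Submodule.smul_mono le_rfl le_top))

lemma redMap_mk {A B : Type} [AddCommGroup A] [Module R A] [AddCommGroup B] [Module R B]
    (f : A →ₗ[R] B) (a : A) : redMap f (Submodule.Quotient.mk a) = Submodule.Quotient.mk (f a) :=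
  rfl

lemma mu_add {A B C : Type} [AddCommGroup A] [Module R A] [AddCommGroup B] [Module R B]
    [AddCommGroup C] [Module R C] [Module.Finite R B] (f : A →ₗ[R] B) (g : B →ₗ[R] C)
    (hg : Function.Surjective g) (hfg : Function.Exact f g)
    (hf : ∀ a, f a ∈ (maximalIdeal R • ⊤ : Submodule R B) →
      a ∈ (maximalIdeal R • ⊤ : Submodule R A)) : mu R B = mu R A + mu R C := by
  have := hasRN (R := R)
  have := strongRank (R := R)
  unfold mu
  have hinj : Function.Injective (redMap f) := by
    rw [injective_iff_map_eq_zero]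
    intro a ha
    obtain ⟨a, rfl⟩ := Submodule.Quotient.mk_surjective _ a
    rw [redMap_mk, Submodule.Quotient.mk_eq_zero] at ha
    exact (Submodule.Quotient.mk_eq_zero _).mpr (hf a ha)
  have hsurj : Function.Surjective (redMap g) := by
    intro c
    obtain ⟨c, rfl⟩ := Submodule.Quotient.mk_surjective _ c
    obtain ⟨b, rfl⟩ := hg c
    exact ⟨Submodule.Quotient.mk b, rfl⟩
  have hker : LinearMap.ker (redMap g) = LinearMap.range (redMap f) := by
    ext b
    obtain ⟨b, rfl⟩ := Submodule.Quotient.mk_surjective _ b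
    rw [LinearMap.mem_ker, redMap_mk, Submodule.Quotient.mk_eq_zero]
    constructor
    · intro hb
      have h1 : (maximalIdeal R • ⊤ : Submodule R C)
          = Submodule.map g (maximalIdeal R • ⊤ : Submodule R B) := by
        rw [Submodule.map_smul'', Submodule.map_top, LinearMap.range_eq_top.mpr hg]
      rw [h1] at hb
      obtain ⟨b', hb', he⟩ := hb
      obtain ⟨a, ha⟩ := (hfg (b - b')).mp (by rw [map_sub, he, sub_self])
      refine ⟨Submodule.Quotient.mk a, ?_⟩
      rw [redMap_mk, ha, Submodule.Quotient.eq]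
      simpa using hb'
    · rintro ⟨a, ha⟩
      obtain ⟨a, rfl⟩ := Submodule.Quotient.mk_surjective _ a
      rw [redMap_mk, Submodule.Quotient.eq] at ha
      have := Submodule.mem_map_of_mem (f := g) ha
      rw [map_sub, hfg.apply_apply_eq_zero, zero_sub, Submodule.map_smul''] at this
      exact Submodule.smul_mono le_rfl le_top (by simpa using this)
  have : Module.Finite (R ⧸ maximalIdeal R) (B ⧸ (maximalIdeal R • ⊤ : Submodule R B)) :=
    Module.Finite.of_restrictScalars_finite R _ _
  have h := Submodule.finrank_quotient_add_finrank (LinearMap.ker (redMap g))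
  rw [((redMap g).quotKerEquivOfSurjective hsurj).finrank_eq, hker,
    LinearMap.finrank_range_of_inj hinj] at h
  omega

lemma pushout_split {F S : Type} [AddCommGroup F] [Module R F] [Module.Finite R F]
    [AddCommGroup S] [Module R S]
    (hvan : ∀ (X : Type) [AddCommGroup X] [Module R X] [Module.Finite R X]
      (f : R →ₗ[R] X) (g : X →ₗ[R] S),
      Function.Injective f → Function.Surjective g → Function.Exact f g →
      mu R X = mu R R + mu R S →
      ∃ s : S →ₗ[R] X, g ∘ₗ s = LinearMap.id)
    (π : F →ₗ[R] S) (hπ : Function.Surjective π)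
    (φ : LinearMap.ker π →ₗ[R] R) (hφ : ∀ w, φ w ∈ maximalIdeal R) :
    ∃ ψ : F →ₗ[R] R, ψ ∘ₗ (LinearMap.ker π).subtype = φ := by
  let P : Submodule R (R × F) := LinearMap.range (φ.prod (-(LinearMap.ker π).subtype))
  let f : R →ₗ[R] ((R × F) ⧸ P) := P.mkQ ∘ₗ LinearMap.inl R R F
  let g : ((R × F) ⧸ P) →ₗ[R] S := P.liftQ (π ∘ₗ LinearMap.snd R R F) (by
    rintro _ ⟨w, rfl⟩
    simp)
  have hgmk : ∀ r v, g (P.mkQ (r, v)) = π v := fun r v => rfl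
  have hinj : Function.Injective f := by
    rw [injective_iff_map_eq_zero]
    intro r hr
    have : (r, (0 : F)) ∈ P := (Submodule.Quotient.mk_eq_zero _).mp hr
    obtain ⟨w, hw⟩ := this
    have h1 : φ w = r := congrArg Prod.fst hw
    have h2 : -(w : F) = 0 := congrArg Prod.snd hw
    have h3 : w = 0 := Subtype.ext (neg_eq_zero.mp h2)
    rw [← h1, h3, map_zero]
  have hsurj : Function.Surjective g := by
    intro s
    obtain ⟨v, rfl⟩ := hπ s
    exact ⟨P.mkQ (0, v), rfl⟩
  have hexact : Function.Exact f g := by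
    intro x
    obtain ⟨⟨r, v⟩, rfl⟩ := P.mkQ_surjective x
    rw [hgmk]
    constructor
    · intro hv
      refine ⟨r + φ ⟨v, hv⟩, ?_⟩
      change P.mkQ (r + φ ⟨v, hv⟩, 0) = _
      rw [← sub_eq_zero, ← map_sub]
      refine (Submodule.Quotient.mk_eq_zero _).mpr ⟨⟨v, hv⟩, ?_⟩
      ext <;> simp
    · rintro ⟨r', hr'⟩
      have := congrArg g hr'
      rw [hgmk] at this
      rw [← this]
      change π 0 = 0
      simp
  have hmu : mu R ((R × F) ⧸ P) = mu R R + mu R S := by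
    refine mu_add f g hsurj hexact ?_
    intro r hr
    let q : ((R × F) ⧸ P) →ₗ[R] (R ⧸ maximalIdeal R) :=
      P.liftQ ((maximalIdeal R).mkQ ∘ₗ LinearMap.fst R R F) (by
        rintro _ ⟨w, rfl⟩
        exact (Submodule.Quotient.mk_eq_zero _).mpr (hφ w))
    have h1 := Submodule.mem_map_of_mem (f := q) hr
    rw [Submodule.map_smul''] at h1
    have h2 : (maximalIdeal R • (Submodule.map q ⊤)) ≤ ⊥ := by
      rw [Submodule.smul_le]
      intro a ha z _
      obtain ⟨z, rfl⟩ := Ideal.Quotient.mk_surjective z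
      exact (Submodule.Quotient.mk_eq_zero _).mpr ((maximalIdeal R).mul_mem_right _ ha)
    have h3 : q (f r) = 0 := h2 h1
    have h4 : r ∈ maximalIdeal R := (Submodule.Quotient.mk_eq_zero _).mp h3
    have := Submodule.smul_mem_smul h4 (Submodule.mem_top (R := R) (x := (1 : R)))
    simpa using this
  obtain ⟨s, hs⟩ := hvan _ f g hinj hsurj hexact hmu
  have htf := hexact.split_tfae'
  have h01 : (Function.Injective f ∧ ∃ l, g ∘ₗ l = LinearMap.id) ↔
      (Function.Surjective g ∧ ∃ l, l ∘ₗ f = LinearMap.id) := htf.out 0 1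
  obtain ⟨_, r, hr⟩ := h01.mp ⟨hinj, s, hs⟩
  refine ⟨r ∘ₗ P.mkQ ∘ₗ LinearMap.inr R R F, ?_⟩
  ext w
  have h5 : P.mkQ (0, (w : F)) = f (φ w) := by
    change _ = P.mkQ (φ w, 0)
    symm
    rw [← sub_eq_zero, ← map_sub]
    refine (Submodule.Quotient.mk_eq_zero _).mpr ⟨w, ?_⟩
    ext <;> simp
  change r (P.mkQ (0, (w : F))) = _
  rw [h5]
  exact LinearMap.congr_fun hr _

end MuPart

section FinalPart

/-- Prefer `Ext` in universe zero in this section. -/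
local instance (priority := 2000) extUnivZeroB (R : Type) [CommRing R] :
    HasExt.{0} (ModuleCat.{0} R) := inferInstance

variable {R : Type} [CommRing R]

lemma injDim_aux (n : ℕ) : ∀ (N : Type) [AddCommGroup N] [Module R N],
    (∀ J : Ideal R, ∀ i, n < i → EV R N (R ⧸ J) i) → HasFiniteInjDim R N := by
  induction n with
  | zero =>
    intro N _ _ h
    have hN : Module.Injective R N := by
      refine Module.Baer.injective ?_
      intro J g
      obtain ⟨ψ, hψ⟩ := EV.extend (f := J.subtype) (g := J.mkQ) J.injective_subtype
        J.mkQ_surjective (LinearMap.exact_subtype_mkQ J) (h J 1 one_pos) g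
      exact ⟨ψ, fun x hx => LinearMap.congr_fun hψ ⟨x, hx⟩⟩
    have hP : Module.Injective R PUnit.{1} := ⟨fun _ _ _ _ _ _ _ _ _ => ⟨0, fun _ => rfl⟩⟩
    let I : ℕ → ModuleCat.{0} R := fun j => match j with
      | 0 => ModuleCat.of R N
      | _ + 1 => ModuleCat.of R PUnit.{1}
    refine ⟨0, I, fun _ => 0, (LinearMap.id : N →ₗ[R] N), ?_, ?_, ?_, ?_, ?_⟩
    · rintro (_ | j)
      · exact hN
      · exact hP
    · exact fun a b h => h
    · intro b
      exact ⟨fun _ => ⟨b, rfl⟩, fun _ => rfl⟩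
    · intro j b
      exact ⟨fun _ => ⟨0, rfl⟩, fun _ => rfl⟩
    · rintro (_ | j) hj
      · exact absurd hj (lt_irrefl _)
      · exact inferInstanceAs (Subsingleton PUnit.{1})
  | succ n ih =>
    intro N _ _ h
    obtain ⟨P⟩ := EnoughInjectives.presentation (ModuleCat.of R N)
    let E : Type := P.J
    let i : N →ₗ[R] E := P.f.hom
    have hi : Function.Injective i := (ModuleCat.mono_iff_injective P.f).mp P.mono
    have hE : Module.Injective R E := Module.injective_module_of_injective_object R E
      (inj := P.injective)
    have hC : HasFiniteInjDim R (E ⧸ LinearMap.range i) := by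
      refine ih _ ?_
      intro J k hk
      obtain ⟨k, rfl⟩ : ∃ k', k = k' + 1 := ⟨k - 1, by omega⟩
      exact EV.cov hi (Submodule.mkQ_surjective _) (LinearMap.exact_map_mkQ_range i)
        (EV.inj (M := E) k) (h J _ (by omega))
    obtain ⟨m, I', f', ι', hI', hι', h0', hf', hm⟩ := hC
    let I : ℕ → ModuleCat.{0} R := fun j => match j with
      | 0 => ModuleCat.of R E
      | j + 1 => I' j
    let f : ∀ j, (I j →ₗ[R] I (j+1)) := fun j => match j with
      | 0 => (ι' ∘ₗ (LinearMap.range i).mkQ : E →ₗ[R] I' 0)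
      | j + 1 => f' j
    refine ⟨m + 1, I, f, i, ?_, hi, ?_, ?_, ?_⟩
    · rintro (_ | j)
      · exact hE
      · exact hI' j
    · intro b
      change ι' ((LinearMap.range i).mkQ b) = 0 ↔ b ∈ Set.range i
      rw [← LinearMap.exact_map_mkQ_range i b]
      constructor
      · intro hb
        exact hι' (hb.trans (map_zero _).symm)
      · intro hb
        rw [hb, map_zero]
    · rintro (_ | j)
      · intro b
        change f' 0 b = 0 ↔ _
        rw [h0' b]
        constructor
        · rintro ⟨c, rfl⟩
          obtain ⟨e, rfl⟩ := (LinearMap.range i).mkQ_surjective c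
          exact ⟨e, rfl⟩
        · rintro ⟨e, rfl⟩
          exact ⟨(LinearMap.range i).mkQ e, rfl⟩
      · exact hf' j
    · rintro (_ | j) hj
      · omega
      · exact hm j (by omega)

variable [IsLocalRing R]

lemma cyc_contra {i : ℕ}
    (h : EC R R ((R ⧸ maximalIdeal R) × (R ⧸ maximalIdeal R)) i) :
    EV R R (R ⧸ maximalIdeal R) i := by
  let K := R ⧸ maximalIdeal R
  obtain ⟨e, he⟩ := h
  refine EV.of_zero fun α => ?_
  have hkill : ∀ a ∈ maximalIdeal R, a • e = 0 := by
    intro a ha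
    have h1 : a • 𝟙 (ModuleCat.of R (K × K)) = 0 := by
      apply ModuleCat.hom_ext
      apply LinearMap.ext
      rintro ⟨x1, x2⟩
      obtain ⟨x1, rfl⟩ := Ideal.Quotient.mk_surjective x1
      obtain ⟨x2, rfl⟩ := Ideal.Quotient.mk_surjective x2
      exact Prod.ext
        (Ideal.Quotient.eq_zero_iff_mem.mpr ((maximalIdeal R).mul_mem_right x1 ha))
        (Ideal.Quotient.eq_zero_iff_mem.mpr ((maximalIdeal R).mul_mem_right x2 ha))
    rw [← Ext.mk₀_id_comp e, ← Ext.smul_comp, ← Ext.mk₀_smul, h1, Ext.mk₀_zero, Ext.zero_comp]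
  have hcomp : ∀ (s : K →ₗ[R] K × K) (p : K × K →ₗ[R] K),
      (Ext.mk₀ (ModuleCat.ofHom s)).comp
        ((Ext.mk₀ (ModuleCat.ofHom p)).comp α (zero_add i)) (zero_add i)
      = (Ext.mk₀ (ModuleCat.ofHom (p ∘ₗ s))).comp α (zero_add i) := by
    intro s p
    rw [Ext.mk₀_comp_mk₀_assoc]
    rfl
  have hid : (Ext.mk₀ (ModuleCat.ofHom (LinearMap.id : K →ₗ[R] K))).comp α (zero_add i) = α :=
    Ext.mk₀_id_comp α
  have hz : (Ext.mk₀ (ModuleCat.ofHom (0 : K →ₗ[R] K))).comp α (zero_add i) = 0 := by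
    have : ModuleCat.ofHom (0 : K →ₗ[R] K) = 0 := rfl
    rw [this, Ext.mk₀_zero, Ext.zero_comp]
  obtain ⟨a, ha⟩ := he ((Ext.mk₀ (ModuleCat.ofHom (LinearMap.fst R K K))).comp α (zero_add i))
  obtain ⟨b, hb⟩ := he ((Ext.mk₀ (ModuleCat.ofHom (LinearMap.snd R K K))).comp α (zero_add i))
  have h11 := hcomp (LinearMap.inl R K K) (LinearMap.fst R K K)
  have h12 := hcomp (LinearMap.inl R K K) (LinearMap.snd R K K)
  have h22 := hcomp (LinearMap.inr R K K) (LinearMap.snd R K K)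
  rw [LinearMap.fst_comp_inl, hid, ha] at h11
  rw [LinearMap.snd_comp_inl, hz, hb] at h12
  rw [LinearMap.snd_comp_inr, hid, hb] at h22
  by_cases hbm : b ∈ maximalIdeal R
  · rw [← h22, hkill b hbm, Ext.comp_zero]
  · have hu : IsUnit b := by
      by_contra hn
      exact hbm ((mem_maximalIdeal _).mpr hn)
    obtain ⟨c, hc⟩ := hu.exists_left_inv
    rw [Ext.comp_smul] at h11 h12
    have h3 := congrArg (fun z => c • z) h12
    simp only [smul_smul, hc, one_smul, smul_zero] at h3
    rw [← h11, h3, smul_zero]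

lemma mu_le_of_span {n : ℕ} (g : Fin n → R) (hg : Ideal.span (Set.range g) = maximalIdeal R) :
    mu R ↥(maximalIdeal R) ≤ n := by
  have := strongRank (R := R)
  have hgm : ∀ i, g i ∈ maximalIdeal R := fun i => hg ▸ Ideal.subset_span ⟨i, rfl⟩
  let q := (maximalIdeal R • ⊤ : Submodule R (maximalIdeal R)).mkQ
  let v : Fin n → (maximalIdeal R) ⧸ (maximalIdeal R • ⊤ : Submodule R (maximalIdeal R)) :=
    fun i => q ⟨g i, hgm i⟩
  have hs : Submodule.span (R ⧸ maximalIdeal R) (Set.range v) = ⊤ := by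
    rw [eq_top_iff]
    intro z _
    obtain ⟨⟨a, ha⟩, rfl⟩ := Submodule.mkQ_surjective _ z
    have ha' := ha
    rw [← hg, Ideal.mem_span_range_iff_exists_fun] at ha'
    obtain ⟨c, rfl⟩ := ha'
    have h1 : (⟨∑ i, c i * g i, ha⟩ : maximalIdeal R) =
        ∑ i, c i • (⟨g i, hgm i⟩ : maximalIdeal R) := by
      ext; simp
    rw [h1, map_sum]
    refine Submodule.sum_mem _ fun i _ => ?_
    have h3 : v i ∈ Submodule.span (R ⧸ maximalIdeal R) (Set.range v) :=
      Submodule.subset_span (Set.mem_range_self i)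
    exact Submodule.smul_mem _ (Ideal.Quotient.mk (maximalIdeal R) (c i)) h3
  have h2 := finrank_range_le_card (R := R ⧸ maximalIdeal R) v
  rw [Set.finrank, hs, finrank_top, Fintype.card_fin] at h2
  exact h2

variable [IsNoetherianRing R]

lemma depth_ext (d : ℕ) (hCM : depthGE R R d) : ∀ i < d, EV R R (R ⧸ maximalIdeal R) i := by
  obtain ⟨rs, rfl, hmem, hreg⟩ := hCM
  intro i hi
  have : Module.Finite R (ModuleCat.of R (R ⧸ maximalIdeal R)) :=
    inferInstanceAs (Module.Finite R (R ⧸ maximalIdeal R))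
  have : Module.Finite R (ModuleCat.of R R) := inferInstanceAs (Module.Finite R R)
  refine ModuleCat.subsingleton_ext_of_exists_isRegular (maximalIdeal R)
    (ModuleCat.of R (R ⧸ maximalIdeal R)) ?_ (ModuleCat.of R R) ?_ rs hmem hreg i hi
  · change Module.support R (R ⧸ maximalIdeal R) ⊆ _
    rw [Module.support_eq_zeroLocus, Ideal.annihilator_quotient]
  · change (maximalIdeal R) • (⊤ : Ideal R) < ⊤
    rw [smul_eq_mul, Ideal.mul_top]
    exact lt_top_iff_ne_top.mpr (Ideal.IsPrime.ne_top inferInstance)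

variable {d : ℕ} {y : ℕ → R} {I : ℕ → Ideal R}

lemma RS.embdim (h : RS d y I) (k : ℕ) (hk : maximalIdeal R ^ k ≤ I d)
    (h2 : maximalIdeal R ^ 2 ≤ I d) (h1 : EV R R (R ⧸ maximalIdeal R) (d + 1)) :
    ∃ z ∈ maximalIdeal R, maximalIdeal R ≤ Ideal.span {z} ⊔ I d := by
  by_contra hcon
  push Not at hcon
  have hc0 := hcon 0 (zero_mem _)
  obtain ⟨z1, hz1, hz1'⟩ := SetLike.not_le_iff_exists.mp hc0
  obtain ⟨z2, hz2, hz2'⟩ := SetLike.not_le_iff_exists.mp (hcon z1 hz1)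
  have hz1d : z1 ∉ I d := fun hh => hz1' (Ideal.mem_sup_right hh)
  let K := R ⧸ maximalIdeal R
  have hlift : ∀ z ∈ maximalIdeal R, maximalIdeal R ≤
      LinearMap.ker (LinearMap.toSpanSingleton R (R ⧸ I d) (Ideal.Quotient.mk _ z)) := by
    intro z hz a ha
    change Ideal.Quotient.mk (I d) (a * z) = 0
    refine Ideal.Quotient.eq_zero_iff_mem.mpr (h2 ?_)
    rw [pow_two]; exact Ideal.mul_mem_mul ha hz
  let l1 : K →ₗ[R] (R ⧸ I d) := Submodule.liftQ _ _ (hlift z1 hz1)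
  let l2 : K →ₗ[R] (R ⧸ I d) := Submodule.liftQ _ _ (hlift z2 hz2)
  let ι : K × K →ₗ[R] (R ⧸ I d) := l1.coprod l2
  have hι : Function.Injective ι := by
    rw [injective_iff_map_eq_zero]
    rintro ⟨a, b⟩ hab
    obtain ⟨a, rfl⟩ := Ideal.Quotient.mk_surjective a
    obtain ⟨b, rfl⟩ := Ideal.Quotient.mk_surjective b
    have h3 : Ideal.Quotient.mk (I d) (a * z1 + b * z2) = 0 := hab
    rw [Ideal.Quotient.eq_zero_iff_mem] at h3
    have hbm : b ∈ maximalIdeal R := by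
      by_contra hb
      have hu : IsUnit b := by
        by_contra hn
        exact hb ((mem_maximalIdeal _).mpr hn)
      apply hz2'
      have h4 : b * z2 ∈ Ideal.span {z1} ⊔ I d := by
        have := Ideal.sub_mem (Ideal.span {z1} ⊔ I d) (Ideal.mem_sup_right h3)
          (Ideal.mem_sup_left (Ideal.mem_span_singleton'.mpr ⟨a, rfl⟩))
        simpa using this
      exact (Ideal.unit_mul_mem_iff_mem _ hu).mp h4
    have ham : a ∈ maximalIdeal R := by
      by_contra hb
      have hu : IsUnit a := by
        by_contra hn
        exact hb ((mem_maximalIdeal _).mpr hn)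
      apply hz1d
      have h5 : b * z2 ∈ I d := h2 (by rw [pow_two]; exact Ideal.mul_mem_mul hbm hz2)
      have h4 : a * z1 ∈ I d := by
        have := Ideal.sub_mem _ h3 h5
        simpa using this
      exact (Ideal.unit_mul_mem_iff_mem _ hu).mp h4
    rw [Ideal.Quotient.eq_zero_iff_mem.mpr hbm, Ideal.Quotient.eq_zero_iff_mem.mpr ham]
    rfl
  have hC : EV R R ((R ⧸ I d) ⧸ LinearMap.range ι) (d + 1) := by
    refine EV.finlen _ k h1 _ (hk.trans ?_)
    refine le_trans ?_ ((LinearMap.range ι).mkQ.annihilator_le_of_surjective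
      (Submodule.mkQ_surjective _))
    exact (Ideal.annihilator_quotient (I := I d)).ge
  have hEC : EC R R (K × K) d := EC.left hι (Submodule.mkQ_surjective _)
    (LinearMap.exact_map_mkQ_range ι) (h.cyc d le_rfl) hC
  refine h.nonvanish d le_rfl (EV.finlen d k (cyc_contra hEC) _ ?_)
  exact hk.trans (Ideal.annihilator_quotient (I := I d)).ge

lemma shift_ext (b : ℕ → ℕ) (f : ∀ j : ℕ, ((Fin (b (j+1)) → R) →ₗ[R] (Fin (b j) → R)))
    (ε : (Fin (b 0) → R) →ₗ[R] R ⧸ maximalIdeal R) (hε : Function.Surjective ε)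
    (h0 : Function.Exact (f 0) ε) (hex : ∀ j, Function.Exact (f (j+1)) (f j)) (j : ℕ) :
    ∀ n, EV R R (LinearMap.range (f j)) (n + 1) → EV R R (R ⧸ maximalIdeal R) (n + 1 + j + 1) := by
  induction j with
  | zero =>
    intro n hn
    refine EV.right (f := (LinearMap.range (f 0)).subtype) (g := ε)
      (Submodule.injective_subtype _) hε ?_ hn (EV.proj _)
    intro u
    rw [h0 u]
    simp
  | succ j ih =>
    intro n hn
    have h1 : EV R R (LinearMap.range (f j)) (n + 1 + 1) := by
      refine EV.right (f := (LinearMap.range (f (j+1))).subtype) (g := (f j).rangeRestrict)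
        (Submodule.injective_subtype _) (f j).surjective_rangeRestrict ?_ hn (EV.proj _)
      intro u
      rw [← Subtype.coe_inj]
      change f j u = 0 ↔ _
      rw [hex j u]
      simp
    have h3 := ih (n + 1) h1
    have e : n + 1 + 1 + j + 1 = n + 1 + (j + 1) + 1 := by omega
    rwa [e] at h3

lemma RS.ext_k (h : RS d y I) (h2 : maximalIdeal R ^ 2 ≤ I d)
    (S : Type) [AddCommGroup S] [Module R S]
    (hS : IsMinSyzygyOfResidueField R d S)
    (hvan : ∀ (X : Type) [AddCommGroup X] [Module R X] [Module.Finite R X]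
      (f : R →ₗ[R] X) (g : X →ₗ[R] S),
      Function.Injective f → Function.Surjective g → Function.Exact f g →
      mu R X = mu R R + mu R S →
      ∃ s : S →ₗ[R] X, g ∘ₗ s = LinearMap.id) :
    EV R R (R ⧸ maximalIdeal R) (d + 1) := by
  by_cases hm : maximalIdeal R ≤ I d
  · rw [le_antisymm hm (h.le d)]
    exact h.pd R d le_rfl d le_rfl
  obtain ⟨b, f, ε, hε, h0, hex, _, hmin, hcase⟩ := hS
  have hπ : ∃ π : (Fin (b d) → R) →ₗ[R] S, Function.Surjective π ∧ Function.Exact (f d) π := by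
    rcases hcase with ⟨rfl, ⟨e⟩⟩ | ⟨j, rfl, ⟨e⟩⟩
    · refine ⟨e.symm.toLinearMap ∘ₗ ε, e.symm.surjective.comp hε, ?_⟩
      intro u
      rw [← h0 u]
      simp
    · refine ⟨e.symm.toLinearMap ∘ₗ (f j).rangeRestrict,
        e.symm.surjective.comp (f j).surjective_rangeRestrict, ?_⟩
      intro u
      rw [← hex j u]
      simp [← Subtype.coe_inj]
  obtain ⟨π, hπ, hπe⟩ := hπ
  have hS1 : EV R R S 1 := by
    refine EV.of_extend (f := (LinearMap.ker π).subtype) (g := π)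
      (Submodule.injective_subtype _) hπ (fun u => by simp) ?_
    intro φ
    refine pushout_split hvan π hπ φ ?_
    rintro ⟨w, hw⟩
    obtain ⟨u, rfl⟩ := (hπe w).mp hw
    let p : (Fin (b (d+1)) → R) →ₗ[R] LinearMap.ker π :=
      (f d).codRestrict _ (fun u => hπe.apply_apply_eq_zero u)
    refine h.nofree b f hex (hmin d) h2 hm (φ ∘ₗ p) ?_ u
    intro v
    have : p (f (d+1) v) = 0 := Subtype.ext ((hex d).apply_apply_eq_zero v)
    rw [LinearMap.comp_apply, this, map_zero]
  rcases hcase with ⟨rfl, ⟨e⟩⟩ | ⟨j, rfl, ⟨e⟩⟩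
  · exact EV.congr e hS1
  · have h3 := shift_ext b f ε hε h0 hex j 0 (EV.congr e hS1)
    have e : 0 + 1 + j + 1 = j + 1 + 1 := by omega
    rwa [e] at h3

end FinalPart


/-- Let `(R,𝔪,k)` be a Cohen–Macaulay Noetherian local ring of dimension `d` with minimal
multiplicity.  If `Ext¹_R(Ω^d k, R)^μ = 0` (every `μ`-additive short exact sequence
`0 → R → X → Ω^d k → 0` of finitely generated modules splits), then
`Ext^{d+1}_R(k, R) = 0`, `R` is Gorenstein (of finite injective dimension over itself),
and `μ(𝔪) ≤ d + 1` (`R` is a hypersurface). -/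
theorem stmt12 (R : Type) [CommRing R] [IsLocalRing R] [IsNoetherianRing R]
    (d : ℕ) (hdim : ringKrullDim R = d) (hCM : depthGE R R d)
    (hminmult : ∃ x : Fin d → R, (∀ i, x i ∈ maximalIdeal R) ∧
      (∃ k : ℕ, maximalIdeal R ^ k ≤ Ideal.span (Set.range x)) ∧
      maximalIdeal R ^ 2 = Ideal.span (Set.range x) * maximalIdeal R)
    (S : Type) [AddCommGroup S] [Module R S] [Module.Finite R S]
    (hS : IsMinSyzygyOfResidueField R d S)
    (hvan : ∀ (X : Type) [AddCommGroup X] [Module R X] [Module.Finite R X]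
      (f : R →ₗ[R] X) (g : X →ₗ[R] S),
      Function.Injective f → Function.Surjective g → Function.Exact f g →
      mu R X = mu R R + mu R S →
      ∃ s : S →ₗ[R] X, g ∘ₗ s = LinearMap.id) :
    Subsingleton
      (Abelian.Ext (ModuleCat.of R (R ⧸ maximalIdeal R)) (ModuleCat.of R R) (d + 1)) ∧
    HasFiniteInjDim R R ∧
    mu R ↥(maximalIdeal R) ≤ d + 1 := by
  obtain ⟨x, hx, ⟨k, hk⟩, h2⟩ := hminmult
  obtain ⟨y, I, h, hI⟩ := RS.exists d x hx k hk (depth_ext d hCM)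
  have h2' : maximalIdeal R ^ 2 ≤ I d := by
    rw [h2, hI]; exact Ideal.mul_le_left (I := Ideal.span (Set.range x)) (J := maximalIdeal R)
  have hk' : maximalIdeal R ^ k ≤ I d := hI ▸ hk
  have h1 : EV R R (R ⧸ maximalIdeal R) (d + 1) := h.ext_k h2' S hS hvan
  refine ⟨?_, ?_, ?_⟩
  · have h1' : Subsingleton (Abelian.Ext.{0} (ModuleCat.of R (R ⧸ maximalIdeal R))
        (ModuleCat.of R R) (d + 1)) := h1
    exact (Abelian.Ext.chgUniv.{0, 1}
      (X := ModuleCat.of R (R ⧸ maximalIdeal R)) (Y := ModuleCat.of R R)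
      (n := d + 1)).subsingleton
  · refine injDim_aux d R ?_
    intro J i hi
    refine bass d ?_ _ i hi
    intro i hi
    obtain ⟨n, rfl⟩ : ∃ n, i = d + 1 + n := ⟨i - (d + 1), by omega⟩
    exact h.all_k k hk' h1 n
  · obtain ⟨z, hz, hle⟩ := h.embdim k hk' h2' h1
    refine mu_le_of_span (Fin.cons z x : Fin (d + 1) → R) ?_
    rw [Fin.range_cons, Ideal.span_insert, ← hI]
    refine le_antisymm (sup_le ?_ (h.le d)) hle
    rwa [Ideal.span_singleton_le_iff_mem]
end
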